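/- arXiv:1906.07888 — 8 statements merged into one kernel-verified Lean document; each statement's English description precedes it below -/
import Mathlib

section
/- Let p ≥ 1 and n, m₁, …, m_p be positive integers, β > 0 and σ₁ > p − 1 real numbers, and for each i = 1, …, p let A_i be a real n × m_i matrix of full column rank (i.e., x ↦ A_i x is injective). Then for every family of vectors x_i ∈ ℝ^{m_i}, i = 1, …, p, not all zero, one has β·(σ₁·∑_{i=1}^p ‖A_i x_i‖² − ∑_{i=1}^p ∑_{l≠i} ⟨A_i x_i, A_l x_l⟩) > 0; that is, the block matrix H_x with diagonal blocks σ₁β AᵢᵀAᵢ and off-diagonal (i,l)-blocks −β AᵢᵀA_l is symmetric positive definite. -/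
open Matrix

theorem sum_dotProduct_sum_le_card_mul {ι κ : Type*} [Fintype ι] [Fintype κ]
    (v : ι → κ → ℝ) :
    (∑ i, v i) ⬝ᵥ (∑ i, v i) ≤ (Fintype.card ι : ℝ) * ∑ i, v i ⬝ᵥ v i := by
  simp only [dotProduct, Finset.sum_apply, ← sq]
  rw [Finset.sum_comm, Finset.mul_sum]
  exact Finset.sum_le_sum fun k _ => sq_sum_le_card_mul_sum_sq

theorem sum_sum_ne_dotProduct {ι κ : Type*} [Fintype ι] [DecidableEq ι] [Fintype κ]
    (v : ι → κ → ℝ) :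
    ∑ i, ∑ l ∈ Finset.univ.filter (fun l => l ≠ i), v i ⬝ᵥ v l =
      (∑ i, v i) ⬝ᵥ (∑ i, v i) - ∑ i, v i ⬝ᵥ v i := by
  rw [sum_dotProduct, ← Finset.sum_sub_distrib]
  refine Finset.sum_congr rfl fun i _ => ?_
  rw [dotProduct_sum, Finset.filter_ne', ← Finset.add_sum_erase _ _ (Finset.mem_univ i)]
  ring

theorem stmt_1 (p n : ℕ) (hp : 1 ≤ p) (hn : 0 < n)
    (m : Fin p → ℕ) (hm : ∀ i, 0 < m i)
    (β σ₁ : ℝ) (hβ : 0 < β) (hσ₁ : σ₁ > (p : ℝ) - 1)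
    (A : (i : Fin p) → Matrix (Fin n) (Fin (m i)) ℝ)
    (hA : ∀ i, Function.Injective (A i).mulVec)
    (x : (i : Fin p) → (Fin (m i) → ℝ)) (hx : ∃ i, x i ≠ 0) :
    β * (σ₁ * ∑ i, (A i).mulVec (x i) ⬝ᵥ (A i).mulVec (x i) -
      ∑ i, ∑ l ∈ Finset.univ.filter (fun l => l ≠ i),
        (A i).mulVec (x i) ⬝ᵥ (A l).mulVec (x l)) > 0 := by
  obtain ⟨j, hj⟩ := hx
  have hAj : A j *ᵥ x j ≠ 0 := fun h => hj (hA j (h.trans (mulVec_zero _).symm))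
  have nonneg (w : Fin n → ℝ) : 0 ≤ w ⬝ᵥ w := Finset.sum_nonneg fun k _ => mul_self_nonneg (w k)
  have hS : 0 < ∑ i, (A i *ᵥ x i) ⬝ᵥ (A i *ᵥ x i) :=
    Finset.sum_pos' (fun i _ => nonneg _) ⟨j, Finset.mem_univ j,
      (nonneg _).lt_of_ne' fun h => hAj (dotProduct_self_eq_zero.1 h)⟩
  have hle := sum_dotProduct_sum_le_card_mul fun i => A i *ᵥ x i
  rw [Fintype.card_fin] at hle
  refine mul_pos hβ ?_
  rw [sum_sum_ne_dotProduct fun i => A i *ᵥ x i]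
  nlinarith [mul_pos (sub_pos.2 hσ₁) hS]
end

section
/- Let q ≥ 1 be an integer and τ, s, σ₂ real numbers with τ < 1, s < 1, τ + s > 0 and σ₂ > q − 1. Then the (q+1) × (q+1) real symmetric matrix T defined by T_{jj} = σ₂ + 1 − s for 1 ≤ j ≤ q, T_{jl} = −s for 1 ≤ j ≠ l ≤ q, T_{j,q+1} = T_{q+1,j} = s − 1 for 1 ≤ j ≤ q, and T_{q+1,q+1} = 2 − τ − s, is positive definite. -/
theorem stmt_3 (q : ℕ) (hq : 1 ≤ q) (τ s σ₂ : ℝ)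
    (hτ : τ < 1) (hs : s < 1) (hτs : τ + s > 0) (hσ₂ : σ₂ > (q : ℝ) - 1) :
    (Matrix.of fun i j : Fin (q + 1) =>
      if i.val < q ∧ j.val < q then (if i = j then σ₂ + 1 - s else -s)
      else if i.val < q ∨ j.val < q then s - 1
      else 2 - τ - s).PosDef := by
  refine Matrix.PosDef.of_dotProduct_mulVec_pos ?_ fun x hx => ?_
  · ext i j
    simp [Matrix.conjTranspose_apply, and_comm, or_comm, eq_comm]
  have hcs : (∑ i : Fin q, x i.castSucc) ^ 2 ≤ q * ∑ i : Fin q, x i.castSucc ^ 2 := by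
    simpa using sq_sum_le_card_mul_sum_sq (s := Finset.univ) (f := fun i : Fin q => x i.castSucc)
  have entry (i j : Fin q) (y : ℝ) : (if i = j then σ₂ + 1 - s else -s) * y =
      (if i = j then (σ₂ + 1) * y else 0) - s * y := by
    split_ifs <;> ring
  have row (i : Fin q) : x i.castSucc * ((σ₂ + 1) * x i.castSucc
      - s * ∑ j : Fin q, x j.castSucc + (s - 1) * x (Fin.last q)) =
      (σ₂ + 1) * x i.castSucc ^ 2 + x i.castSucc *
        ((s - 1) * x (Fin.last q) - s * ∑ j : Fin q, x j.castSucc) := by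
    ring
  simp only [dotProduct, Matrix.mulVec, Pi.star_apply, star_trivial, Matrix.of_apply,
    Fin.sum_univ_castSucc, Fin.val_castSucc, Fin.val_last, Fin.is_lt, lt_irrefl, and_true,
    and_false, or_true, or_false, if_true, if_false, Fin.castSucc_inj,
    entry, Finset.sum_sub_distrib, ← Finset.mul_sum, Finset.sum_ite_eq, Finset.mem_univ,
    row, Finset.sum_add_distrib, ← Finset.sum_mul]
  set S := ∑ i : Fin q, x i.castSucc
  set N := ∑ i : Fin q, x i.castSucc ^ 2 with hN
  set y := x (Fin.last q)
  have hN0 : 0 ≤ N := Finset.sum_nonneg fun i _ => sq_nonneg _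
  have key : 0 < (σ₂ + 1 - q) * N + (1 - τ) * y ^ 2 := by
    have h1 : 0 ≤ (σ₂ + 1 - q) * N := mul_nonneg (by linarith) hN0
    have h2 : 0 ≤ (1 - τ) * y ^ 2 := mul_nonneg (by linarith) (sq_nonneg _)
    by_cases hy : y = 0
    · have hNpos : 0 < N := by
        refine lt_of_le_of_ne hN0 fun h => hx ?_
        have hzero := (Finset.sum_eq_zero_iff_of_nonneg fun i _ => sq_nonneg _).1 (hN.symm.trans h.symm)
        funext i
        refine Fin.lastCases hy (fun j => ?_) i
        simpa using hzero j (Finset.mem_univ j)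
      have := mul_pos (show 0 < σ₂ + 1 - q by linarith) hNpos
      linarith
    · have := mul_pos (sub_pos.2 hτ) (pow_pos (abs_pos.2 hy) 2)
      rw [sq_abs] at this
      linarith
  nlinarith [mul_nonneg (sub_pos.2 hs).le (sq_nonneg (S - y))]
end

section
/- Let p, q ≥ 1 and n, m₁, …, m_p, d₁, …, d_q be positive integers, β > 0, σ₁ > p − 1, σ₂ > q − 1, and (τ, s) real numbers with τ < 1, s < 1, τ + s > 0. For each i let A_i be a real n × m_i matrix of full column rank and for each j let B_j be a real n × d_j matrix of full column rank. Then for all x_i ∈ ℝ^{m_i}, y_j ∈ ℝ^{d_j}, λ ∈ ℝ^n, not all zero, the quadratic form β·(σ₁·∑_i ‖A_i x_i‖² − ∑_i ∑_{l≠i} ⟨A_i x_i, A_l x_l⟩) + (σ₂ + 1 − s)β·∑_j ‖B_j y_j‖² − sβ·∑_j ∑_{l≠j} ⟨B_j y_j, B_l y_l⟩ + 2(s − 1)·∑_j ⟨B_j y_j, λ⟩ + ((2 − τ − s)/β)·‖λ‖² is strictly positive; that is, the matrix G = Q + Qᵀ − MᵀQ of the GS-ADMM analysis is symmetric positive definite.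 -/
open Matrix

theorem sum_dotProduct_sum_self_le {ι κ : Type*} [Fintype ι] [Fintype κ] (v : ι → κ → ℝ) :
    (∑ i, v i) ⬝ᵥ (∑ i, v i) ≤ Fintype.card ι * ∑ i, v i ⬝ᵥ v i := by
  simp only [dotProduct, Finset.sum_apply, ← pow_two]
  rw [Finset.sum_comm, Finset.mul_sum]
  exact Finset.sum_le_sum fun k _ => sq_sum_le_card_mul_sum_sq

theorem dotProduct_self_nonneg' {κ : Type*} [Fintype κ] (v : κ → ℝ) : 0 ≤ v ⬝ᵥ v :=
  Finset.sum_nonneg fun i _ => mul_self_nonneg (v i)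

theorem dotProduct_self_pos' {κ : Type*} [Fintype κ] {v : κ → ℝ} (hv : v ≠ 0) : 0 < v ⬝ᵥ v :=
  (dotProduct_self_nonneg' v).lt_of_ne fun h => hv (dotProduct_self_eq_zero.mp h.symm)

theorem sum_mulVec_dotProduct_self_pos {ι κ : Type*} [Fintype ι] [Fintype κ] {m : ι → ℕ}
    (A : (i : ι) → Matrix κ (Fin (m i)) ℝ) (hA : ∀ i, Function.Injective (A i).mulVec)
    (x : (i : ι) → (Fin (m i) → ℝ)) (hx : ∃ i, x i ≠ 0) :
    0 < ∑ i, (A i).mulVec (x i) ⬝ᵥ (A i).mulVec (x i) := by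
  obtain ⟨i, hi⟩ := hx
  refine Finset.sum_pos' (fun j _ => dotProduct_self_nonneg' _) ⟨i, Finset.mem_univ i, ?_⟩
  exact dotProduct_self_pos' fun h => hi (hA i (by rw [h, mulVec_zero]))

theorem stmt_5 (p q n : ℕ) (hp : 1 ≤ p) (hq : 1 ≤ q) (hn : 0 < n)
    (m : Fin p → ℕ) (hm : ∀ i, 0 < m i) (d : Fin q → ℕ) (hd : ∀ j, 0 < d j)
    (β σ₁ σ₂ τ s : ℝ) (hβ : 0 < β)
    (hσ₁ : σ₁ > (p : ℝ) - 1) (hσ₂ : σ₂ > (q : ℝ) - 1)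
    (hτ : τ < 1) (hs : s < 1) (hτs : τ + s > 0)
    (A : (i : Fin p) → Matrix (Fin n) (Fin (m i)) ℝ)
    (hA : ∀ i, Function.Injective (A i).mulVec)
    (B : (j : Fin q) → Matrix (Fin n) (Fin (d j)) ℝ)
    (hB : ∀ j, Function.Injective (B j).mulVec)
    (x : (i : Fin p) → (Fin (m i) → ℝ))
    (y : (j : Fin q) → (Fin (d j) → ℝ)) (lam : Fin n → ℝ)
    (hxyl : (∃ i, x i ≠ 0) ∨ (∃ j, y j ≠ 0) ∨ lam ≠ 0) :
    β * (σ₁ * ∑ i, (A i).mulVec (x i) ⬝ᵥ (A i).mulVec (x i) -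
        ∑ i, ∑ l ∈ Finset.univ.filter (fun l => l ≠ i),
          (A i).mulVec (x i) ⬝ᵥ (A l).mulVec (x l)) +
      (σ₂ + 1 - s) * β * ∑ j, (B j).mulVec (y j) ⬝ᵥ (B j).mulVec (y j) -
      s * β * ∑ j, ∑ l ∈ Finset.univ.filter (fun l => l ≠ j),
        (B j).mulVec (y j) ⬝ᵥ (B l).mulVec (y l) +
      2 * (s - 1) * ∑ j, (B j).mulVec (y j) ⬝ᵥ lam +
      ((2 - τ - s) / β) * (lam ⬝ᵥ lam) > 0 := by
  rw [sum_sum_ne_dotProduct (fun i => (A i).mulVec (x i)),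
    sum_sum_ne_dotProduct (fun j => (B j).mulVec (y j)), ← sum_dotProduct]
  have hX := sum_dotProduct_sum_self_le (fun i => (A i).mulVec (x i))
  have hY := sum_dotProduct_sum_self_le (fun j => (B j).mulVec (y j))
  rw [Fintype.card_fin] at hX hY
  have hx0 : 0 ≤ ∑ i, (A i).mulVec (x i) ⬝ᵥ (A i).mulVec (x i) :=
    Finset.sum_nonneg fun i _ => dotProduct_self_nonneg' _
  have hy0 : 0 ≤ ∑ j, (B j).mulVec (y j) ⬝ᵥ (B j).mulVec (y j) :=
    Finset.sum_nonneg fun j _ => dotProduct_self_nonneg' _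
  have hl0 := dotProduct_self_nonneg' lam
  have hsq := dotProduct_self_nonneg' (β • (∑ j, (B j).mulVec (y j)) - lam)
  have hpos : 0 < ∑ i, (A i).mulVec (x i) ⬝ᵥ (A i).mulVec (x i) ∨
      0 < ∑ j, (B j).mulVec (y j) ⬝ᵥ (B j).mulVec (y j) ∨ 0 < lam ⬝ᵥ lam :=
    hxyl.imp (sum_mulVec_dotProduct_self_pos A hA x)
      (Or.imp (sum_mulVec_dotProduct_self_pos B hB y) dotProduct_self_pos')
  simp only [sub_dotProduct, dotProduct_sub, smul_dotProduct, dotProduct_smul, smul_eq_mul,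
    dotProduct_comm lam (∑ j, (B j).mulVec (y j))] at hsq
  set Sx := ∑ i, (A i).mulVec (x i) ⬝ᵥ (A i).mulVec (x i)
  set Sy := ∑ j, (B j).mulVec (y j) ⬝ᵥ (B j).mulVec (y j)
  set X := (∑ i, (A i).mulVec (x i)) ⬝ᵥ (∑ i, (A i).mulVec (x i))
  set Y := (∑ j, (B j).mulVec (y j)) ⬝ᵥ (∑ j, (B j).mulVec (y j))
  set C := (∑ j, (B j).mulVec (y j)) ⬝ᵥ lam
  set L := lam ⬝ᵥ lam
  have key : β * (σ₁ * Sx - (X - Sx)) + (σ₂ + 1 - s) * β * Sy - s * β * (Y - Sy) +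
      2 * (s - 1) * C + (2 - τ - s) / β * L =
      β * (σ₁ + 1 - p) * Sx + β * (p * Sx - X) + β * (σ₂ + 1 - q) * Sy + β * (q * Sy - Y) +
      (1 - s) / β * (β * (β * Y) - β * C - (β * C - L)) + (1 - τ) / β * L := by
    field_simp
    ring
  have cx : 0 < β * (σ₁ + 1 - p) := mul_pos hβ (by linarith)
  have cy : 0 < β * (σ₂ + 1 - q) := mul_pos hβ (by linarith)
  have cl : 0 < (1 - τ) / β := div_pos (by linarith) hβ
  have cs : 0 ≤ (1 - s) / β := (div_pos (by linarith) hβ).le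
  have h₁ := mul_nonneg hβ.le (sub_nonneg.mpr hX)
  have h₂ := mul_nonneg hβ.le (sub_nonneg.mpr hY)
  have h₃ := mul_nonneg cs (by linarith : 0 ≤ β * (β * Y) - β * C - (β * C - L))
  have tx := mul_nonneg cx.le hx0
  have ty := mul_nonneg cy.le hy0
  have tl := mul_nonneg cl.le hl0
  rw [gt_iff_lt]
  refine lt_of_lt_of_eq ?_ key.symm
  rcases hpos with h | h | h
  · have := mul_pos cx h
    linarith
  · have := mul_pos cy h
    linarith
  · have := mul_pos cl h
    linarith
end

section
/- Let N ≥ 1 and let Q, M, H be real N × N matrices with H symmetric and H·M = Q. Let w, w̃, w* ∈ ℝ^N, set w′ = w − M(w − w̃) and G = Q + Qᵀ − MᵀQ, and assume ⟨w̃ − w*, Q(w − w̃)⟩ ≥ 0. Then ⟨w′ − w*, H(w′ − w*)⟩ ≤ ⟨w − w*, H(w − w*)⟩ − ⟨w − w̃, G(w − w̃)⟩. -/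
open Matrix

theorem stmt_7 (N : ℕ) (hN : 1 ≤ N)
    (Q M H : Matrix (Fin N) (Fin N) ℝ) (hH : H.IsSymm) (hHM : H * M = Q)
    (w wt wstar : Fin N → ℝ)
    (w' : Fin N → ℝ) (hw' : w' = w - M.mulVec (w - wt))
    (G : Matrix (Fin N) (Fin N) ℝ) (hG : G = Q + Qᵀ - Mᵀ * Q)
    (hvi : (wt - wstar) ⬝ᵥ Q.mulVec (w - wt) ≥ 0) :
    (w' - wstar) ⬝ᵥ H.mulVec (w' - wstar) ≤
      (w - wstar) ⬝ᵥ H.mulVec (w - wstar) - (w - wt) ⬝ᵥ G.mulVec (w - wt) := by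
  subst hw' hG
  have hvi' : (w - wstar - (w - wt)) ⬝ᵥ Q *ᵥ (w - wt) ≥ 0 := by
    simpa only [sub_sub_sub_cancel_left] using hvi
  have hsplit : w - M *ᵥ (w - wt) - wstar = w - wstar - M *ᵥ (w - wt) := by abel
  rw [hsplit]
  generalize w - wt = d at *
  generalize w - wstar = a at *
  have hHMd : H *ᵥ (M *ᵥ d) = Q *ᵥ d := by rw [mulVec_mulVec, hHM]
  have hcross : (M *ᵥ d) ⬝ᵥ H *ᵥ a = a ⬝ᵥ Q *ᵥ d := by
    rw [dotProduct_mulVec, ← mulVec_transpose, hH.eq, hHMd, dotProduct_comm]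
  have hQt : d ⬝ᵥ Qᵀ *ᵥ d = d ⬝ᵥ Q *ᵥ d := by
    rw [mulVec_transpose, dotProduct_comm, ← dotProduct_mulVec]
  have hMQ : d ⬝ᵥ (Mᵀ * Q) *ᵥ d = (M *ᵥ d) ⬝ᵥ Q *ᵥ d := by
    rw [← mulVec_mulVec, dotProduct_mulVec, vecMul_transpose]
  simp only [mulVec_sub, sub_mulVec, add_mulVec, sub_dotProduct, dotProduct_sub,
    dotProduct_add, hHMd, hcross, hQt, hMQ] at hvi' ⊢
  linarith
end

section
/- Let N ≥ 1 and let Q, M be real N × N matrices. Let w, w̃, w′, w̃′ ∈ ℝ^N satisfy w′ = w − M(w − w̃), and set Δ = (w − w̃) − (w′ − w̃′). If ⟨w̃ − w̃′, QΔ⟩ ≥ 0, then ⟨w − w̃, MᵀQ Δ⟩ ≥ (1/2)·⟨Δ, (Q + Qᵀ)Δ⟩. -/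
open Matrix

theorem stmt_8 (N : ℕ) (hN : 1 ≤ N)
    (Q M : Matrix (Fin N) (Fin N) ℝ)
    (w wt w' wt' : Fin N → ℝ) (hw' : w' = w - M.mulVec (w - wt))
    (Δ : Fin N → ℝ) (hΔ : Δ = (w - wt) - (w' - wt'))
    (hvi : (wt - wt') ⬝ᵥ Q.mulVec Δ ≥ 0) :
    (w - wt) ⬝ᵥ (Mᵀ * Q).mulVec Δ ≥ (1 / 2) * (Δ ⬝ᵥ (Q + Qᵀ).mulVec Δ) := by
  have hM : M *ᵥ (w - wt) = Δ + (wt - wt') := by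
    rw [hΔ, hw']
    abel
  have hL : (w - wt) ⬝ᵥ (Mᵀ * Q) *ᵥ Δ = Δ ⬝ᵥ Q *ᵥ Δ + (wt - wt') ⬝ᵥ Q *ᵥ Δ := by
    rw [← mulVec_mulVec, dotProduct_mulVec, vecMul_transpose, hM, add_dotProduct]
  have hT : Δ ⬝ᵥ Qᵀ *ᵥ Δ = Δ ⬝ᵥ Q *ᵥ Δ := by
    rw [dotProduct_mulVec, vecMul_transpose, dotProduct_comm]
  rw [hL, add_mulVec, dotProduct_add, hT]
  linarith
end

section
/- Let N ≥ 1 and let Q, M, H be real N × N matrices with H symmetric and H·M = Q. Let w, w̃, w′, w̃′ ∈ ℝ^N satisfy w′ = w − M(w − w̃), set Δ = (w − w̃) − (w′ − w̃′) and G = Q + Qᵀ − MᵀQ, and assume ⟨w̃ − w̃′, QΔ⟩ ≥ 0. Then ⟨M(w − w̃), H·M(w − w̃)⟩ − ⟨M(w′ − w̃′), H·M(w′ − w̃′)⟩ ≥ ⟨Δ, GΔ⟩. -/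
open Matrix

theorem Matrix.IsSymm.dotProduct_mulVec_comm {n R : Type*} [Fintype n] [CommSemiring R]
    {A : Matrix n n R} (hA : A.IsSymm) (x y : n → R) :
    x ⬝ᵥ A *ᵥ y = y ⬝ᵥ A *ᵥ x := by
  rw [dotProduct_mulVec, ← mulVec_transpose, hA.eq, dotProduct_comm]

theorem stmt_9 (N : ℕ) (hN : 1 ≤ N)
    (Q M H : Matrix (Fin N) (Fin N) ℝ) (hH : H.IsSymm) (hHM : H * M = Q)
    (w wt w' wt' : Fin N → ℝ) (hw' : w' = w - M.mulVec (w - wt))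
    (Δ : Fin N → ℝ) (hΔ : Δ = (w - wt) - (w' - wt'))
    (G : Matrix (Fin N) (Fin N) ℝ) (hG : G = Q + Qᵀ - Mᵀ * Q)
    (hvi : (wt - wt') ⬝ᵥ Q.mulVec Δ ≥ 0) :
    M.mulVec (w - wt) ⬝ᵥ H.mulVec (M.mulVec (w - wt)) -
      M.mulVec (w' - wt') ⬝ᵥ H.mulVec (M.mulVec (w' - wt')) ≥
        Δ ⬝ᵥ G.mulVec Δ := by
  have hwt : wt - wt' = M *ᵥ (w - wt) - Δ := by
    rw [hΔ, hw']; abel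
  have hb : w' - wt' = (w - wt) - Δ := by
    rw [hΔ]; abel
  have hsymm := hH.dotProduct_mulVec_comm (M *ᵥ (w - wt)) (M *ᵥ Δ)
  have hQ : Q *ᵥ Δ = H *ᵥ (M *ᵥ Δ) := by rw [mulVec_mulVec, hHM]
  have hG' : Δ ⬝ᵥ G *ᵥ Δ =
      2 * (Δ ⬝ᵥ H *ᵥ (M *ᵥ Δ)) - (M *ᵥ Δ) ⬝ᵥ H *ᵥ (M *ᵥ Δ) := by
    have hQT : Δ ⬝ᵥ Qᵀ *ᵥ Δ = Δ ⬝ᵥ Q *ᵥ Δ := by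
      rw [mulVec_transpose, dotProduct_comm, ← dotProduct_mulVec]
    have hMQ : Δ ⬝ᵥ (Mᵀ * Q) *ᵥ Δ = (M *ᵥ Δ) ⬝ᵥ Q *ᵥ Δ := by
      rw [← mulVec_mulVec, dotProduct_mulVec, vecMul_transpose]
    rw [hG, sub_mulVec, add_mulVec, dotProduct_sub, dotProduct_add, hQT, hMQ, hQ]
    ring
  rw [hwt, hQ, sub_dotProduct] at hvi
  rw [hG', hb]
  rw [mulVec_sub M (w - wt), mulVec_sub H, dotProduct_sub, sub_dotProduct, sub_dotProduct]
  linarith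
end

section
/- Let N ≥ 1, let H be a real symmetric positive semidefinite N × N matrix, let M be a real N × N matrix, let (w^k)_{k≥0} and (w̃^k)_{k≥0} be sequences in ℝ^N, let w* ∈ ℝ^N and ξ > 0. Assume that for every k ≥ 0: (i) ⟨w^{k+1} − w*, H(w^{k+1} − w*)⟩ ≤ ⟨w^k − w*, H(w^k − w*)⟩ − ξ·⟨M(w^k − w̃^k), H·M(w^k − w̃^k)⟩, and (ii) ⟨M(w^{k+1} − w̃^{k+1}), H·M(w^{k+1} − w̃^{k+1})⟩ ≤ ⟨M(w^k − w̃^k), H·M(w^k − w̃^k)⟩. Then for every integer t ≥ 0, ⟨M(w^t − w̃^t), H·M(w^t − w̃^t)⟩ ≤ ⟨w^0 − w*, H(w^0 − w*)⟩ / ((t+1)·ξ). -/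
open Matrix

/-- If `a` is nonnegative and drops by at least `ξ * b k` at step `k`, with `b` antitone, then
`b t` is at most `a 0 / ((t + 1) * ξ)`. -/
theorem le_div_of_antitone_of_le_sub {a b : ℕ → ℝ} {ξ : ℝ} (hξ : 0 < ξ) (ha : ∀ k, 0 ≤ a k)
    (hab : ∀ k, a (k + 1) ≤ a k - ξ * b k) (hb : Antitone b) (t : ℕ) :
    b t ≤ a 0 / ((t + 1 : ℝ) * ξ) := by
  have key : ∀ t : ℕ, a (t + 1) + (t + 1 : ℝ) * (ξ * b t) ≤ a 0 := by
    intro t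
    induction t with
    | zero => have := hab 0; norm_num at this ⊢; linarith
    | succ t ih =>
      have hmono : (t + 1 : ℝ) * (ξ * b (t + 1)) ≤ (t + 1 : ℝ) * (ξ * b t) := by
        have := hb t.le_succ
        gcongr
      have := hab (t + 1)
      push_cast
      linarith
  rw [le_div_iff₀ (by positivity)]
  linarith [key t, ha (t + 1)]

theorem stmt_11 (N : ℕ) (hN : 1 ≤ N)
    (H M : Matrix (Fin N) (Fin N) ℝ) (hH : H.PosSemidef)
    (w wt : ℕ → (Fin N → ℝ)) (wstar : Fin N → ℝ) (ξ : ℝ) (hξ : 0 < ξ)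
    (h1 : ∀ k : ℕ,
      (w (k + 1) - wstar) ⬝ᵥ H.mulVec (w (k + 1) - wstar) ≤
        (w k - wstar) ⬝ᵥ H.mulVec (w k - wstar) -
          ξ * (M.mulVec (w k - wt k) ⬝ᵥ H.mulVec (M.mulVec (w k - wt k))))
    (h2 : ∀ k : ℕ,
      M.mulVec (w (k + 1) - wt (k + 1)) ⬝ᵥ
          H.mulVec (M.mulVec (w (k + 1) - wt (k + 1))) ≤
        M.mulVec (w k - wt k) ⬝ᵥ H.mulVec (M.mulVec (w k - wt k))) :
    ∀ t : ℕ,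
      M.mulVec (w t - wt t) ⬝ᵥ H.mulVec (M.mulVec (w t - wt t)) ≤
        (w 0 - wstar) ⬝ᵥ H.mulVec (w 0 - wstar) / ((t + 1 : ℝ) * ξ) := by
  exact le_div_of_antitone_of_le_sub (a := fun k => (w k - wstar) ⬝ᵥ H.mulVec (w k - wstar)) hξ
    (fun k => by simpa using hH.dotProduct_mulVec_nonneg (w k - wstar)) h1
    (antitone_nat_of_succ_le h2)
end

section
/- Let E be a real inner product space, S ⊆ E a nonempty set, ε > 0, and let (w^k)_{k≥0}, (g_k)_{k≥0} be sequences in E and ℝ respectively. Assume for every k ≥ 0 there exists w*_k ∈ S with ‖w^k − w*_k‖ equal to the infimum distance from w^k to S, such that ‖w^{k+1} − w*_k‖² ≤ ‖w^k − w*_k‖² − g_k and g_k ≥ ε·(infDist(w^{k+1}, S))². Then for every k ≥ 0, (infDist(w^k, S))² ≤ (1/(1+ε))^k · (infDist(w^0, S))²; in particular infDist(w^k, S) ≤ r^k·infDist(w^0, S) with r = 1/√(1+ε) ∈ (0, 1). -/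
theorem stmt_13 {E : Type*} [NormedAddCommGroup E] [InnerProductSpace ℝ E]
    (S : Set E) (hS : S.Nonempty) (ε : ℝ) (hε : 0 < ε)
    (w : ℕ → E) (g : ℕ → ℝ)
    (h : ∀ k : ℕ, ∃ wstar ∈ S, ‖w k - wstar‖ = Metric.infDist (w k) S ∧
      ‖w (k + 1) - wstar‖ ^ 2 ≤ ‖w k - wstar‖ ^ 2 - g k ∧
      g k ≥ ε * (Metric.infDist (w (k + 1)) S) ^ 2) :
    (∀ k : ℕ, (Metric.infDist (w k) S) ^ 2 ≤
        (1 / (1 + ε)) ^ k * (Metric.infDist (w 0) S) ^ 2) ∧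
      0 < 1 / Real.sqrt (1 + ε) ∧ 1 / Real.sqrt (1 + ε) < 1 ∧
      ∀ k : ℕ, Metric.infDist (w k) S ≤
        (1 / Real.sqrt (1 + ε)) ^ k * Metric.infDist (w 0) S := by
  have one_step (k : ℕ) : Metric.infDist (w (k + 1)) S ^ 2 ≤
      1 / (1 + ε) * Metric.infDist (w k) S ^ 2 := by
    obtain ⟨z, hz, hdist, hdecr, hgap⟩ := h k
    have hle : Metric.infDist (w (k + 1)) S ≤ ‖w (k + 1) - z‖ := by
      rw [← dist_eq_norm]
      exact Metric.infDist_le_dist_of_mem hz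
    have hsq : Metric.infDist (w (k + 1)) S ^ 2 ≤ ‖w (k + 1) - z‖ ^ 2 :=
      pow_le_pow_left₀ Metric.infDist_nonneg hle 2
    rw [hdist] at hdecr
    rw [one_div_mul_eq_div, le_div_iff₀ (by positivity)]
    linarith
  have sq_bound (k : ℕ) : Metric.infDist (w k) S ^ 2 ≤
      (1 / (1 + ε)) ^ k * Metric.infDist (w 0) S ^ 2 := by
    induction k with
    | zero => simp
    | succ k ih =>
      calc Metric.infDist (w (k + 1)) S ^ 2
          ≤ 1 / (1 + ε) * Metric.infDist (w k) S ^ 2 := one_step k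
        _ ≤ 1 / (1 + ε) * ((1 / (1 + ε)) ^ k * Metric.infDist (w 0) S ^ 2) := by gcongr
        _ = (1 / (1 + ε)) ^ (k + 1) * Metric.infDist (w 0) S ^ 2 := by ring
  have hsqrt : 1 < Real.sqrt (1 + ε) := by
    rw [Real.lt_sqrt zero_le_one]
    linarith
  refine ⟨sq_bound, by positivity, ?_, fun k => ?_⟩
  · rwa [div_lt_one (by positivity)]
  · have hnonneg : 0 ≤ Metric.infDist (w 0) S := Metric.infDist_nonneg
    refine (pow_le_pow_iff_left₀ Metric.infDist_nonneg (by positivity) two_ne_zero).mp ?_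
    rw [mul_pow, ← pow_mul, mul_comm k 2, pow_mul, div_pow, one_pow,
      Real.sq_sqrt (by positivity)]
    exact sq_bound k
end
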